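/- Let M be an ergodic row-stochastic matrix on a finite state space Ω, let κ̃ be its generalized contraction coefficient, and let ξ ∈ (0,1/2). Then the mixing time satisfies t_mix(ξ) ≤ (1 + ln(1/ξ))/(1 − κ̃). -/

import Mathlib

variable {Ω : Type*} [Fintype Ω] [DecidableEq Ω] [Nonempty Ω]

/-- A probability distribution on `Ω`. -/
def IsDist (f : Ω → ℝ) : Prop := (∀ x, 0 ≤ f x) ∧ ∑ x, f x = 1

/-- A row-stochastic (Markov) matrix. -/
def IsStochastic (M : Matrix Ω Ω ℝ) : Prop :=
  (∀ i j, 0 ≤ M i j) ∧ ∀ i, ∑ j, M i j = 1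

/-- Ergodicity: some power of `M` is entrywise positive. -/
def IsErgodic (M : Matrix Ω Ω ℝ) : Prop := ∃ p : ℕ, 0 < p ∧ ∀ i j, 0 < (M ^ p) i j

/-- Total variation distance between two distributions on `Ω`. -/
noncomputable def tvDist (μ ν : Ω → ℝ) : ℝ := (1 / 2) * ∑ x, |μ x - ν x|

/-- Dobrushin contraction coefficient `κ(M) = max_{i,j} ‖M(i,·) − M(j,·)‖_TV`. -/
noncomputable def dobrushin (M : Matrix Ω Ω ℝ) : ℝ :=
  Finset.univ.sup' Finset.univ_nonempty fun p : Ω × Ω => tvDist (M p.1) (M p.2)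

/-- Generalized contraction coefficient `κ̃ = 1 − sup_{s ≥ 1} (1 − κ(M^s))/s`. -/
noncomputable def genCC (M : Matrix Ω Ω ℝ) : ℝ :=
  1 - ⨆ s : {n : ℕ // 0 < n}, (1 - dobrushin (M ^ (s : ℕ))) / ((s : ℕ) : ℝ)

/-- Distance to stationarity `h(t) = sup_{μ ∈ Δ_Ω} ‖μ M^t − π‖_TV`. -/
noncomputable def distToStat (M : Matrix Ω Ω ℝ) (π : Ω → ℝ) (t : ℕ) : ℝ :=
  ⨆ μ : {f : Ω → ℝ // IsDist f}, tvDist (Matrix.vecMul μ.1 (M ^ t)) π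

/-- Mixing time `t_mix(ξ) = min{t ∈ ℕ : h(t) < ξ}` (with `ℕ = {1,2,…}`). -/
noncomputable def mixTime (M : Matrix Ω Ω ℝ) (π : Ω → ℝ) (ξ : ℝ) : ℕ :=
  sInf {t : ℕ | 0 < t ∧ distToStat M π t < ξ}

omit [Nonempty Ω] in
theorem IsStochastic.pow {M : Matrix Ω Ω ℝ} (hM : IsStochastic M) (n : ℕ) :
    IsStochastic (M ^ n) := by
  induction n with
  | zero =>
    refine ⟨fun i j => ?_, fun i => ?_⟩
    · rw [pow_zero, Matrix.one_apply]; split_ifs <;> norm_num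
    · simp [Matrix.one_apply]
  | succ n ih =>
    refine ⟨fun i j => ?_, fun i => ?_⟩
    · rw [pow_succ, Matrix.mul_apply]
      exact Finset.sum_nonneg fun k _ => mul_nonneg (ih.1 i k) (hM.1 k j)
    · simp_rw [pow_succ, Matrix.mul_apply]
      rw [Finset.sum_comm]
      simp_rw [← Finset.mul_sum, hM.2, mul_one, ih.2]

omit [DecidableEq Ω] [Nonempty Ω] in
theorem IsDist.vecMul {M : Matrix Ω Ω ℝ} (hM : IsStochastic M) {μ : Ω → ℝ} (hμ : IsDist μ) :
    IsDist (Matrix.vecMul μ M) := by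
  refine ⟨fun y => Finset.sum_nonneg fun x _ => mul_nonneg (hμ.1 x) (hM.1 x y), ?_⟩
  simp only [Matrix.vecMul, dotProduct]
  rw [Finset.sum_comm]
  simp_rw [← Finset.mul_sum, hM.2, mul_one, hμ.2]

omit [DecidableEq Ω] [Nonempty Ω] in
theorem tvDist_nonneg (μ ν : Ω → ℝ) : 0 ≤ tvDist μ ν :=
  mul_nonneg (by norm_num) (Finset.sum_nonneg fun _ _ => abs_nonneg _)

omit [DecidableEq Ω] [Nonempty Ω] in
theorem tvDist_le_one {μ ν : Ω → ℝ} (hμ : IsDist μ) (hν : IsDist ν) : tvDist μ ν ≤ 1 := by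
  have h : ∑ x, |μ x - ν x| ≤ ∑ x, (μ x + ν x) := Finset.sum_le_sum fun x _ =>
    abs_le.2 ⟨by linarith [hμ.1 x, hν.1 x], by linarith [hμ.1 x, hν.1 x]⟩
  rw [Finset.sum_add_distrib, hμ.2, hν.2] at h
  unfold tvDist
  linarith

omit [DecidableEq Ω] in
theorem tvDist_lt_one {μ ν : Ω → ℝ} (hμ : IsDist μ) (hν : IsDist ν)
    (hμ0 : ∀ x, 0 < μ x) (hν0 : ∀ x, 0 < ν x) : tvDist μ ν < 1 := by
  have h : ∑ x, |μ x - ν x| < ∑ x, (μ x + ν x) :=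
    Finset.sum_lt_sum_of_nonempty Finset.univ_nonempty fun x _ =>
      abs_lt.2 ⟨by linarith [hμ0 x, hν0 x], by linarith [hμ0 x, hν0 x]⟩
  rw [Finset.sum_add_distrib, hμ.2, hν.2] at h
  unfold tvDist
  linarith

omit [DecidableEq Ω] in
theorem tvDist_le_dobrushin (M : Matrix Ω Ω ℝ) (i j : Ω) :
    tvDist (M i) (M j) ≤ dobrushin M :=
  Finset.le_sup' (fun p : Ω × Ω => tvDist (M p.1) (M p.2)) (Finset.mem_univ (i, j))

omit [DecidableEq Ω] in
theorem dobrushin_nonneg (M : Matrix Ω Ω ℝ) : 0 ≤ dobrushin M :=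
  let i := Classical.arbitrary Ω
  (tvDist_nonneg (M i) (M i)).trans (tvDist_le_dobrushin M i i)

omit [DecidableEq Ω] in
theorem dobrushin_lt_one {M : Matrix Ω Ω ℝ} (hM : IsStochastic M) (hpos : ∀ i j, 0 < M i j) :
    dobrushin M < 1 :=
  (Finset.sup'_lt_iff _).2 fun _ _ => tvDist_lt_one ⟨hM.1 _, hM.2 _⟩ ⟨hM.1 _, hM.2 _⟩
    (hpos _) (hpos _)

omit [DecidableEq Ω] in
/-- Dobrushin's contraction inequality for the total variation distance. -/
theorem tvDist_vecMul_le (M : Matrix Ω Ω ℝ) {μ ν : Ω → ℝ} (h : ∑ x, μ x = ∑ x, ν x) :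
    tvDist (Matrix.vecMul μ M) (Matrix.vecMul ν M) ≤ dobrushin M * tvDist μ ν := by
  let ε : Ω → ℝ := fun y => SignType.sign (Matrix.vecMul μ M y - Matrix.vecMul ν M y)
  have hε : ∀ y, |ε y| ≤ 1 := fun y => by
    simp only [ε]
    cases SignType.sign (Matrix.vecMul μ M y - Matrix.vecMul ν M y) <;> simp
  let f : Ω → ℝ := fun x => ∑ y, M x y * ε y
  have hosc : ∀ i j, f i - f j ≤ 2 * dobrushin M := fun i j => by
    have h1 : f i - f j ≤ ∑ y, |M i y - M j y| := by
      simp only [f]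
      rw [← Finset.sum_sub_distrib]
      refine Finset.sum_le_sum fun y _ => ?_
      rw [← sub_mul]
      refine (le_abs_self _).trans ?_
      rw [abs_mul]
      exact mul_le_of_le_one_right (abs_nonneg _) (hε y)
    have h2 := tvDist_le_dobrushin M i j
    unfold tvDist at h2
    linarith
  obtain ⟨i, hi⟩ := Finite.exists_max f
  have hmid : ∀ x, |f x - (f i - dobrushin M)| ≤ dobrushin M := fun x =>
    abs_le.2 ⟨by linarith [hosc i x], by linarith [hi x]⟩
  have hsum : ∑ y, |Matrix.vecMul μ M y - Matrix.vecMul ν M y|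
      = ∑ x, (μ x - ν x) * (f x - (f i - dobrushin M)) := by
    have h0 : ∑ x, (μ x - ν x) * (f i - dobrushin M) = 0 := by
      rw [← Finset.sum_mul, Finset.sum_sub_distrib, h, sub_self, zero_mul]
    rw [Finset.sum_congr rfl fun x _ => mul_sub (μ x - ν x) (f x) (f i - dobrushin M),
      Finset.sum_sub_distrib, h0, sub_zero]
    simp only [f, Finset.mul_sum]
    rw [Finset.sum_comm]
    refine Finset.sum_congr rfl fun y _ => ?_
    rw [← self_mul_sign]
    change _ * ε y = _
    simp only [Matrix.vecMul, dotProduct]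
    rw [← Finset.sum_sub_distrib, Finset.sum_mul]
    exact Finset.sum_congr rfl fun x _ => by ring
  have hle : ∑ y, |Matrix.vecMul μ M y - Matrix.vecMul ν M y|
      ≤ dobrushin M * ∑ x, |μ x - ν x| := by
    rw [hsum, Finset.mul_sum]
    refine Finset.sum_le_sum fun x _ => (le_abs_self _).trans ?_
    rw [abs_mul, mul_comm]
    exact mul_le_mul_of_nonneg_right (hmid x) (abs_nonneg _)
  unfold tvDist
  linarith

theorem tvDist_vecMul_pow_le {M : Matrix Ω Ω ℝ} (hM : IsStochastic M) {μ π : Ω → ℝ}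
    (hμ : IsDist μ) (hπ : IsDist π) (hstat : Matrix.vecMul π M = π) (k : ℕ) :
    tvDist (Matrix.vecMul μ (M ^ k)) π ≤ dobrushin M ^ k := by
  induction k with
  | zero => simpa using tvDist_le_one hμ hπ
  | succ k ih =>
    have h := tvDist_vecMul_le M (((hμ.vecMul (hM.pow k)).2).trans hπ.2.symm)
    rw [hstat, Matrix.vecMul_vecMul, ← pow_succ] at h
    rw [pow_succ' (dobrushin M)]
    exact h.trans (mul_le_mul_of_nonneg_left ih (dobrushin_nonneg M))

omit [Nonempty Ω] in
theorem vecMul_pow_eq_self {M : Matrix Ω Ω ℝ} {π : Ω → ℝ} (hstat : Matrix.vecMul π M = π)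
    (n : ℕ) : Matrix.vecMul π (M ^ n) = π := by
  induction n with
  | zero => simp
  | succ n ih => rw [pow_succ, ← Matrix.vecMul_vecMul, ih, hstat]

theorem distToStat_mul_le {M : Matrix Ω Ω ℝ} (hM : IsStochastic M) {π : Ω → ℝ}
    (hπ : IsDist π) (hstat : Matrix.vecMul π M = π) (s k : ℕ) :
    distToStat M π (s * k) ≤ dobrushin (M ^ s) ^ k := by
  have : Nonempty {f : Ω → ℝ // IsDist f} := ⟨⟨π, hπ⟩⟩
  refine ciSup_le fun μ => ?_
  rw [pow_mul]
  exact tvDist_vecMul_pow_le (hM.pow s) μ.2 hπ (vecMul_pow_eq_self hstat s) k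

/-- The mixing time bound obtained from the contraction coefficient of one fixed power. -/
theorem mixTime_mul_le {M : Matrix Ω Ω ℝ} (hM : IsStochastic M) {π : Ω → ℝ}
    (hπ : IsDist π) (hstat : Matrix.vecMul π M = π) {ξ : ℝ} (hξ0 : 0 < ξ) (hξ1 : ξ < 1)
    {s : ℕ} (hs : 0 < s) :
    (mixTime M π ξ : ℝ) * ((1 - dobrushin (M ^ s)) / s) ≤ 1 + Real.log (1 / ξ) := by
  have hs' : (0 : ℝ) < s := Nat.cast_pos.2 hs
  have hL : 0 < Real.log (1 / ξ) := Real.log_pos (one_lt_one_div hξ0 hξ1)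
  have hκ := dobrushin_nonneg (M ^ s)
  obtain ⟨δ, hδ⟩ : ∃ δ, δ = 1 - dobrushin (M ^ s) := ⟨_, rfl⟩
  rw [← hδ]
  rcases le_or_gt δ 0 with h0 | h0
  · exact (mul_nonpos_of_nonneg_of_nonpos (Nat.cast_nonneg _)
      (div_nonpos_of_nonpos_of_nonneg h0 hs'.le)).trans (by linarith)
  set k := ⌈Real.log (1 / ξ) / δ⌉₊
  have hk : 0 < k := Nat.ceil_pos.2 (div_pos hL h0)
  have hk1 : Real.log (1 / ξ) ≤ k * δ := (div_le_iff₀ h0).1 (Nat.le_ceil _)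
  have hk2 : (k : ℝ) * δ < Real.log (1 / ξ) + δ := by
    have h := Nat.ceil_lt_add_one (div_pos hL h0).le
    have h := mul_lt_mul_of_pos_right h h0
    rwa [add_mul, one_mul, div_mul_cancel₀ _ h0.ne'] at h
  have hmix : distToStat M π (s * k) < ξ := by
    have hlt : dobrushin (M ^ s) < Real.exp (-δ) := by
      have := Real.add_one_lt_exp (neg_ne_zero.2 h0.ne')
      linarith
    calc distToStat M π (s * k) ≤ dobrushin (M ^ s) ^ k := distToStat_mul_le hM hπ hstat s k
      _ < Real.exp (-δ) ^ k := pow_lt_pow_left₀ hlt hκ hk.ne'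
      _ = Real.exp (k * -δ) := (Real.exp_nat_mul _ _).symm
      _ ≤ Real.exp (Real.log ξ) := by
        rw [one_div, Real.log_inv] at hk1
        exact Real.exp_le_exp.2 (by linarith)
      _ = ξ := Real.exp_log hξ0
  have hle : mixTime M π ξ ≤ s * k := Nat.sInf_le ⟨Nat.mul_pos hs hk, hmix⟩
  calc (mixTime M π ξ : ℝ) * (δ / s) ≤ ((s * k : ℕ) : ℝ) * (δ / s) :=
        mul_le_mul_of_nonneg_right (Nat.cast_le.2 hle) (div_pos h0 hs').le
    _ = k * δ := by push_cast; field_simp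
    _ ≤ 1 + Real.log (1 / ξ) := by linarith

theorem one_sub_genCC_pos {M : Matrix Ω Ω ℝ} (hM : IsStochastic M) (hErg : IsErgodic M) :
    0 < 1 - genCC M := by
  obtain ⟨p, hp, hpos⟩ := hErg
  have hbdd : BddAbove (Set.range fun s : {n : ℕ // 0 < n} =>
      (1 - dobrushin (M ^ (s : ℕ))) / ((s : ℕ) : ℝ)) := by
    refine ⟨1, ?_⟩
    rintro _ ⟨⟨s, hs⟩, rfl⟩
    have hs' : (1 : ℝ) ≤ s := Nat.one_le_cast.2 hs
    exact (div_le_one (by linarith)).2 (by linarith [dobrushin_nonneg (M ^ s)])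
  have hterm : 0 < (1 - dobrushin (M ^ p)) / (p : ℝ) :=
    div_pos (sub_pos.2 (dobrushin_lt_one (hM.pow p) hpos)) (Nat.cast_pos.2 hp)
  rw [genCC, sub_sub_cancel]
  exact hterm.trans_le (le_ciSup hbdd ⟨p, hp⟩)

/-- upper bound `t_mix(ξ) ≤ (1 + ln(1/ξ))/(1 − κ̃)`. -/
theorem mixTime_upper_bound (M : Matrix Ω Ω ℝ) (hM : IsStochastic M)
    (hErg : IsErgodic M) (π : Ω → ℝ) (hπ : IsDist π)
    (hstat : Matrix.vecMul π M = π) (ξ : ℝ) (hξ : ξ ∈ Set.Ioo (0 : ℝ) (1 / 2)) :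
    (mixTime M π ξ : ℝ) ≤ (1 + Real.log (1 / ξ)) / (1 - genCC M) := by
  obtain ⟨hξ0, hξ1⟩ := hξ
  rw [le_div_iff₀ (one_sub_genCC_pos hM hErg), genCC, sub_sub_cancel]
  have : Nonempty {n : ℕ // 0 < n} := ⟨⟨1, one_pos⟩⟩
  rw [Real.mul_iSup_of_nonneg (Nat.cast_nonneg _)]
  exact ciSup_le fun s => mixTime_mul_le hM hπ hstat hξ0 (by linarith) s.2
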